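/- Let $(R,\mathfrak{m},k)$ be a $d$-dimensional Noetherian local ring, and let $I \subseteq R$ be an ideal. Suppose there exist ideals $J_1, J_2$ of $R$ with $\sqrt{J_1 \cap J_2} = \sqrt{I}$, $\sqrt{J_1 + J_2} = \mathfrak{m}$, and $H^{d-1}_I(R) = 0 = H^d_{J_1}(R) = H^d_{J_2}(R)$. Then $H^d_{\mathfrak{m}}(R) = 0$ — contradicting Grothendieck nonvanishing; equivalently, if $H^{d-1}_I(R) = 0$ and $H^d_{J}(R) = 0$ for every ideal $J$ with $\sqrt{J} \neq \mathfrak{m}$, then the punctured spectrum of $R/I$ is connected. -/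

import Mathlib

noncomputable section

universe u

open CategoryTheory Limits Opposite

namespace LCAux
variable {R : Type u} [CommRing R]

def yMap {K L : ChainComplex (ModuleCat.{u} R) ℕ} (φ : K ⟶ L) (Y : ModuleCat.{u} R) :
    L.linearYonedaObj R Y ⟶ K.linearYonedaObj R Y :=
  (HomologicalComplex.unopFunctor _ _).map
    ((((linearYoneda R (ModuleCat.{u} R)).obj Y).rightOp.mapHomologicalComplex _).map φ).op

lemma yMap_f {K L : ChainComplex (ModuleCat.{u} R) ℕ} (φ : K ⟶ L) (Y : ModuleCat.{u} R) (n : ℕ)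
    (f : L.X n ⟶ Y) : ((yMap φ Y).f n).hom f = φ.f n ≫ f := rfl

lemma inv_aux {C : Type*} [Category C] {A A' B B' : C} (e : A ≅ B) (e' : A' ≅ B')
    {g : B ⟶ B'} {f : A ⟶ A'} (h : e.hom ≫ g = f ≫ e'.hom) : g ≫ e'.inv = e.inv ≫ f := by
  rw [Iso.eq_inv_comp, ← Category.assoc, Iso.comp_inv_eq]
  exact h

lemma homologyUnop_nat {K L : ChainComplex (ModuleCat.{u} R)ᵒᵖ ℕ} (φ : K ⟶ L) (n : ℕ) :
    (HomologicalComplex.homologyMap φ n).unop ≫ (HomologicalComplex.homologyUnop K n).inv =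
      (HomologicalComplex.homologyUnop L n).inv ≫
        HomologicalComplex.homologyMap ((HomologicalComplex.unopFunctor _ _).map φ.op) n := by
  have h : (HomologicalComplex.homologyUnop L n).hom ≫
      (HomologicalComplex.homologyMap φ n).unop =
      HomologicalComplex.homologyMap ((HomologicalComplex.unopFunctor _ _).map φ.op) n ≫
        (HomologicalComplex.homologyUnop K n).hom :=
    congrArg Quiver.Hom.unop (HomologicalComplex.homologyOp_hom_naturality
      ((HomologicalComplex.unopFunctor _ _).map φ.op) n)
  exact inv_aux _ _ h

lemma comp_aux {C : Type*} [Category C] {A A' B B' D D' : C} {a : A ⟶ A'} {b' : A' ⟶ B'}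
    {b : A ⟶ B} {c : B ⟶ B'} {d' : B' ⟶ D'} {d : B ⟶ D} {e : D ⟶ D'} (h1 : a ≫ b' = b ≫ c)
    (h2 : c ≫ d' = d ≫ e) : a ≫ b' ≫ d' = (b ≫ d) ≫ e := by
  rw [← Category.assoc, h1, Category.assoc, h2, Category.assoc]

lemma isoExt_nat {X X' : ModuleCat.{u} R} (g : X' ⟶ X) (P' : ProjectiveResolution X')
    (P : ProjectiveResolution X) (φ : P'.complex ⟶ P.complex)
    (comm : φ.f 0 ≫ P.π.f 0 = P'.π.f 0 ≫ g) (n : ℕ) (Y : ModuleCat.{u} R) :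
    ((Ext R (ModuleCat.{u} R) n).map g.op).app Y ≫ (P'.isoExt n Y).hom =
      (P.isoExt n Y).hom ≫ HomologicalComplex.homologyMap (yMap φ Y) n := by
  have h1 := congrArg Quiver.Hom.unop
    (ProjectiveResolution.isoLeftDerivedObj_inv_naturality g P' P φ comm
      ((linearYoneda R (ModuleCat.{u} R)).obj Y).rightOp n)
  have h2 := homologyUnop_nat
    ((((linearYoneda R (ModuleCat.{u} R)).obj Y).rightOp.mapHomologicalComplex _).map φ) n
  rw [unop_comp, unop_comp] at h1
  exact comp_aux h1 h2

/-- class of a cocycle -/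
lemma cls_exists {X : ModuleCat.{u} R} (P : ProjectiveResolution X) (n : ℕ) (Y : ModuleCat.{u} R)
    (x : ((Ext R (ModuleCat.{u} R) n).obj (op X)).obj Y) : 
    ∃ z : (P.complex.linearYonedaObj R Y).cycles n, 
     (P.isoExt n Y).inv ((P.complex.linearYonedaObj R Y).homologyπ n z) = x := by
  have : Function.Surjective ((P.complex.linearYonedaObj R Y).homologyπ n) :=
    (ModuleCat.epi_iff_surjective _).1 inferInstance
  obtain ⟨z, hz⟩ := this ((P.isoExt n Y).hom x)
  exact ⟨z, by rw [hz]; simp⟩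

lemma homologyπ_eq_zero (K : CochainComplex (ModuleCat.{u} R) ℕ) (n : ℕ) (z : K.cycles n)
    (hz : K.homologyπ n z = 0) : ∃ y, K.toCycles ((ComplexShape.up ℕ).prev n) n y = z := by
  have := (ShortComplex.exact_of_g_is_cokernel
    (ShortComplex.mk _ _ (K.toCycles_comp_homologyπ ((ComplexShape.up ℕ).prev n) n))
     (K.homologyIsCokernel _ n rfl))
  rw [ShortComplex.moduleCat_exact_iff] at this
  exact this z hz

lemma homologyπ_nat {K L : CochainComplex (ModuleCat.{u} R) ℕ} (φ : K ⟶ L) (n : ℕ)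
    (z : K.cycles n) : HomologicalComplex.homologyMap φ n (K.homologyπ n z) =
      L.homologyπ n (HomologicalComplex.cyclesMap φ n z) := by
  have := HomologicalComplex.homologyπ_naturality φ n
  exact ConcreteCategory.congr_hom this z

lemma iCycles_nat {K L : CochainComplex (ModuleCat.{u} R) ℕ} (φ : K ⟶ L) (n : ℕ)
    (z : K.cycles n) : L.iCycles n (HomologicalComplex.cyclesMap φ n z) =
      φ.f n (K.iCycles n z) := by
  have := HomologicalComplex.cyclesMap_i φ n
  exact ConcreteCategory.congr_hom this z

lemma cycles_inj {K : CochainComplex (ModuleCat.{u} R) ℕ} (n : ℕ) {z w : K.cycles n}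
    (h : K.iCycles n z = K.iCycles n w) : z = w :=
  (ModuleCat.mono_iff_injective (K.iCycles n)).1 inferInstance h

lemma iCycles_toCycles {K : CochainComplex (ModuleCat.{u} R) ℕ} (m n : ℕ) (y : K.X m) :
    K.iCycles n (K.toCycles m n y) = K.d m n y := by
  have := K.toCycles_i m n
  exact ConcreteCategory.congr_hom this y

lemma d_iCycles {K : CochainComplex (ModuleCat.{u} R) ℕ} (m n : ℕ) (z : K.cycles n) :
    K.d n m (K.iCycles n z) = 0 := by
  have := K.iCycles_d n m
  exact ConcreteCategory.congr_hom this z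

lemma cycles_exists {K : CochainComplex (ModuleCat.{u} R) ℕ} (n : ℕ) (y : K.X n)
    (h : K.d n (n + 1) y = 0) : ∃ z : K.cycles n, K.iCycles n z = y := by
  have := (ShortComplex.exact_of_f_is_kernel
    (ShortComplex.mk _ _ (K.iCycles_d n (n + 1))) (K.cyclesIsKernel _ _ (by simp)))
  rw [ShortComplex.moduleCat_exact_iff] at this
  exact this y h

lemma toCycles_homologyπ {K : CochainComplex (ModuleCat.{u} R) ℕ} (m n : ℕ) (y : K.X m) :
    K.homologyπ n (K.toCycles m n y) = 0 := by
  have := K.toCycles_comp_homologyπ m n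
  exact ConcreteCategory.congr_hom this y

open Abelian in
lemma new_of_old {X Y : ModuleCat.{u} R} (n : ℕ) (x' : Abelian.Ext X Y n) :
    ∃ x : ((Ext R (ModuleCat.{u} R) n).obj (op X)).obj Y, ∀ (X' : ModuleCat.{u} R) (g : X' ⟶ X),
      ((Ext R (ModuleCat.{u} R) n).map g.op).app Y x = 0 →
        (Abelian.Ext.mk₀ g).comp x' (zero_add n) = 0 := by
  let P := projectiveResolution X
  obtain ⟨f, hf, rfl⟩ := P.extMk_surjective x' (n + 1) rfl
  obtain ⟨z, hz⟩ := cycles_exists (K := P.complex.linearYonedaObj R Y) n f hf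
  refine ⟨(P.isoExt n Y).inv ((P.complex.linearYonedaObj R Y).homologyπ n z), fun X' g h => ?_⟩
  let P' := projectiveResolution X'
  let φ : P'.complex ⟶ P.complex := ProjectiveResolution.lift g P' P
  have comm : φ.f 0 ≫ P.π.f 0 = P'.π.f 0 ≫ g := ProjectiveResolution.lift_commutes_zero g P' P
  let Φ : ProjectiveResolution.Hom P' P g := ⟨φ, by simpa using comm⟩
  rw [ProjectiveResolution.mk₀_comp_extMk f _ rfl hf Φ]
  have nat := isoExt_nat g P' P φ comm n Y
  replace nat := ConcreteCategory.congr_hom nat ((P.isoExt n Y).inv ((P.complex.linearYonedaObj R Y).homologyπ n z))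
  simp only [ModuleCat.comp_apply, Iso.inv_hom_id_apply, homologyπ_nat] at nat
  rw [h, map_zero] at nat
  obtain ⟨y, hy⟩ := homologyπ_eq_zero _ _ _ nat.symm
  have e := congrArg ((P'.complex.linearYonedaObj R Y).iCycles n) hy
  rw [iCycles_toCycles, iCycles_nat, hz] at e
  cases n with
  | zero =>
    have : φ.f 0 ≫ f = 0 := by
      rw [← yMap_f]
      refine e.symm.trans ?_
      rw [HomologicalComplex.shape _ _ _ (by simp)]
      rfl
    simp [Φ, this]
  | succ n =>
    rw [ProjectiveResolution.extMk_eq_zero_iff _ _ _ _ _ n rfl]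
    have hp : (ComplexShape.up ℕ).prev (n + 1) = n := by simp
    revert y
    rw [hp]
    intro y hy e
    exact ⟨y, e⟩

lemma old_of_new {X Y : ModuleCat.{u} R} (n : ℕ)
    (x : ((Ext R (ModuleCat.{u} R) (n + 1)).obj (op X)).obj Y) :
    ∃ x' : Abelian.Ext X Y (n + 1), ∀ (X' : ModuleCat.{u} R) (g : X' ⟶ X),
      (Abelian.Ext.mk₀ g).comp x' (zero_add (n + 1)) = 0 →
      ((Ext R (ModuleCat.{u} R) (n + 1)).map g.op).app Y x = 0 := by
  let P := projectiveResolution X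
  obtain ⟨z, rfl⟩ := cls_exists P _ Y x
  let f : P.complex.X (n + 1) ⟶ Y := (P.complex.linearYonedaObj R Y).iCycles (n + 1) z
  have hf : P.complex.d (n + 2) (n + 1) ≫ f = 0 := d_iCycles (n + 2) (n + 1) z
  refine ⟨P.extMk f (n + 2) rfl hf, fun X' g h => ?_⟩
  let P' := projectiveResolution X'
  let φ : P'.complex ⟶ P.complex := ProjectiveResolution.lift g P' P
  have comm : φ.f 0 ≫ P.π.f 0 = P'.π.f 0 ≫ g := ProjectiveResolution.lift_commutes_zero g P' P
  let Φ : ProjectiveResolution.Hom P' P g := ⟨φ, by simpa using comm⟩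
  rw [ProjectiveResolution.mk₀_comp_extMk f _ rfl hf Φ,
    ProjectiveResolution.extMk_eq_zero_iff _ _ _ _ _ n rfl] at h
  obtain ⟨y', hy⟩ := h
  obtain ⟨y, rfl⟩ : ∃ y : (P'.complex.linearYonedaObj R Y).X n, y = y' := ⟨y', rfl⟩
  have nat := isoExt_nat g P' P φ comm (n + 1) Y
  replace nat := (ConcreteCategory.congr_hom nat ((P.isoExt (n + 1) Y).inv
    ((P.complex.linearYonedaObj R Y).homologyπ (n + 1) z)))
  simp only [ModuleCat.comp_apply, Iso.inv_hom_id_apply, homologyπ_nat] at nat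
  have e : HomologicalComplex.cyclesMap (yMap φ Y) (n + 1) z =
      (P'.complex.linearYonedaObj R Y).toCycles n (n + 1) y := by
    apply cycles_inj
    refine (iCycles_nat _ _ _).trans (Eq.trans ?_ (iCycles_toCycles _ _ _).symm)
    exact hy.symm
  rw [e, toCycles_homologyπ] at nat
  have inj : Function.Injective (P'.isoExt (R := R) (n + 1) Y).hom :=
    (ModuleCat.mono_iff_injective (P'.isoExt (R := R) (n + 1) Y).hom).1 inferInstance
  apply inj
  rw [nat, map_zero]

def qm {A B : Ideal R} (h : A ≤ B) : ModuleCat.of R (R ⧸ A) ⟶ ModuleCat.of R (R ⧸ B) :=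
  ModuleCat.ofHom (Submodule.mapQ A B LinearMap.id h)

lemma subsingleton_iff (J : Ideal R) (i : ℕ) (M : ModuleCat.{u} R) :
    Subsingleton ((localCohomology J i).obj M) ↔
      ∀ (t : ℕ) (x : ((Ext R (ModuleCat.{u} R) i).obj (op (ModuleCat.of R (R ⧸ J ^ t)))).obj M),
        ∃ (s : ℕ) (h : t ≤ s), ((Ext R (ModuleCat.{u} R) i).map
          (qm (Ideal.pow_le_pow_right (I := J) h)).op).app M x = 0 := by
  let c := (((evaluation _ _).obj M).mapCocone (colimit.cocone
    (localCohomology.diagram (localCohomology.idealPowersDiagram J) i)))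
  have hc : IsColimit c := isColimitOfPreserves _ (colimit.isColimit _)
  change Subsingleton c.pt ↔ _
  have : PreservesFilteredColimitsOfSize.{0, 0} (forget (ModuleCat.{u} R)) :=
    preservesFilteredColimitsOfSize_shrink.{0, u, 0, u} _
  constructor
  · intro hs t x
    obtain ⟨k, f, g, e⟩ := (Concrete.isColimit_rep_eq_iff_exists _ (i := op (op t)) (j := op (op t)) hc x 0).1
      (hs.elim _ _)
    refine ⟨k.unop.unop, f.unop.unop.down.down, ?_⟩
    rw [map_zero] at e
    exact e
  · intro H
    suffices ∀ x : c.pt, x = 0 from ⟨fun a b => (this a).trans (this b).symm⟩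
    intro x
    obtain ⟨t, y, rfl⟩ := Concrete.isColimit_exists_rep _ hc x
    obtain ⟨s, h, e⟩ := H t.unop.unop y
    refine (Concrete.isColimit_rep_eq_of_exists _ y 0 ⟨op (op s), (homOfLE h).op.op, (homOfLE h).op.op, ?_⟩).trans (map_zero (c.ι.app t).hom)
    rw [map_zero]
    exact e

def Dies (J : Ideal R) (i : ℕ) (M : ModuleCat.{u} R) : Prop :=
  ∀ (t : ℕ) (x : Abelian.Ext (ModuleCat.of R (R ⧸ J ^ t)) M i),
    ∃ (s : ℕ) (h : t ≤ s), (Abelian.Ext.mk₀ (qm (Ideal.pow_le_pow_right (I := J) h))).comp x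
      (zero_add i) = 0

lemma dies_of {J : Ideal R} {i : ℕ} {M : ModuleCat.{u} R}
    (h : Subsingleton ((localCohomology J i).obj M)) : Dies J i M := by
  rw [subsingleton_iff] at h
  intro t x'
  obtain ⟨x, hx⟩ := new_of_old i x'
  obtain ⟨s, hs, e⟩ := h t x
  exact ⟨s, hs, hx _ _ e⟩

lemma of_dies {J : Ideal R} {i : ℕ} {M : ModuleCat.{u} R} (h : Dies J (i + 1) M) :
    Subsingleton ((localCohomology J (i + 1)).obj M) := by
  rw [subsingleton_iff]
  intro t x
  obtain ⟨x', hx⟩ := old_of_new i x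
  obtain ⟨s, hs, e⟩ := h t x'
  exact ⟨s, hs, hx _ _ e⟩

def mvS (A B : Ideal R) : ShortComplex (ModuleCat.{u} R) :=
  ShortComplex.mk (X₁ := ModuleCat.of R (R ⧸ (A ⊓ B))) (X₂ := ModuleCat.of R ((R ⧸ A) × (R ⧸ B)))
    (X₃ := ModuleCat.of R (R ⧸ (A ⊔ B)))
    (ModuleCat.ofHom (LinearMap.prod (Submodule.mapQ _ A LinearMap.id inf_le_left)
      (Submodule.mapQ _ B LinearMap.id inf_le_right)))
    (ModuleCat.ofHom (LinearMap.coprod (Submodule.mapQ A _ LinearMap.id le_sup_left)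
      (-(Submodule.mapQ B _ LinearMap.id le_sup_right))))
    (by
      ext x
      simp)

lemma mvS_exact (A B : Ideal R) : (mvS A B).ShortExact where
  exact := by
    rw [ShortComplex.moduleCat_exact_iff]
    rintro ⟨x, y⟩ h
    obtain ⟨x, rfl⟩ := Submodule.Quotient.mk_surjective _ x
    obtain ⟨y, rfl⟩ := Submodule.Quotient.mk_surjective _ y
    change (Submodule.Quotient.mk x : R ⧸ (A ⊔ B)) + - Submodule.Quotient.mk y = 0 at h
    rw [← sub_eq_add_neg, ← Submodule.Quotient.mk_sub, Submodule.Quotient.mk_eq_zero,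
      Submodule.mem_sup] at h
    obtain ⟨a, ha, b, hb, e⟩ := h
    refine ⟨Submodule.Quotient.mk (x - a), ?_⟩
    refine Prod.ext ?_ ?_
    · change (Submodule.Quotient.mk (x - a) : R ⧸ A) = Submodule.Quotient.mk x
      rw [Submodule.Quotient.eq]
      simpa using ha
    · change (Submodule.Quotient.mk (x - a) : R ⧸ B) = Submodule.Quotient.mk y
      rw [Submodule.Quotient.eq]
      have : x - a - y = b := by linear_combination -e
      rwa [this]
  mono_f := by
    rw [ModuleCat.mono_iff_injective, injective_iff_map_eq_zero]
    intro x h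
    obtain ⟨x, rfl⟩ := Submodule.Quotient.mk_surjective _ x
    change ((Submodule.Quotient.mk x : R ⧸ A), (Submodule.Quotient.mk x : R ⧸ B)) = 0 at h
    rw [Prod.mk_eq_zero, Submodule.Quotient.mk_eq_zero, Submodule.Quotient.mk_eq_zero] at h
    exact (Submodule.Quotient.mk_eq_zero _).2 h
  epi_g := by
    rw [ModuleCat.epi_iff_surjective]
    intro x
    obtain ⟨x, rfl⟩ := Submodule.Quotient.mk_surjective _ x
    refine ⟨(Submodule.Quotient.mk x, 0), ?_⟩
    change (Submodule.Quotient.mk x : R ⧸ (A ⊔ B)) + - Submodule.Quotient.mk 0 = _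
    simp

def mvMap {A B A' B' : Ideal R} (hA : A' ≤ A) (hB : B' ≤ B) : mvS A' B' ⟶ mvS A B where
  τ₁ := qm (inf_le_inf hA hB)
  τ₂ := ModuleCat.ofHom (LinearMap.prodMap (Submodule.mapQ _ _ LinearMap.id hA)
    (Submodule.mapQ _ _ LinearMap.id hB))
  τ₃ := qm (sup_le_sup hA hB)
  comm₁₂ := by
    apply ModuleCat.hom_ext
    apply LinearMap.ext
    intro x
    obtain ⟨x, rfl⟩ := Submodule.Quotient.mk_surjective _ x
    rfl
  comm₂₃ := by
    ext ⟨x, y⟩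
    obtain ⟨x, rfl⟩ := Submodule.Quotient.mk_surjective _ x
    obtain ⟨y, rfl⟩ := Submodule.Quotient.mk_surjective _ y
    rfl

/-- restriction of classes -/
def res {A B : Ideal R} (h : A ≤ B) {M : ModuleCat.{u} R} {i : ℕ}
    (x : Abelian.Ext (ModuleCat.of R (R ⧸ B)) M i) : Abelian.Ext (ModuleCat.of R (R ⧸ A)) M i :=
  (Abelian.Ext.mk₀ (qm h)).comp x (zero_add i)

lemma qm_comp {A B C : Ideal R} (h : A ≤ B) (h' : B ≤ C) : qm h ≫ qm h' = qm (h.trans h') := by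
  ext x
  rfl

lemma res_res {A B C : Ideal R} (h : A ≤ B) (h' : B ≤ C) {M : ModuleCat.{u} R} {i : ℕ}
    (x : Abelian.Ext (ModuleCat.of R (R ⧸ C)) M i) : res h (res h' x) = res (h.trans h') x := by
  simp only [res]
  rw [← qm_comp h h', Abelian.Ext.mk₀_comp_mk₀_assoc]

lemma res_zero {A B : Ideal R} (h : A ≤ B) {M : ModuleCat.{u} R} {i : ℕ} :
    res h (0 : Abelian.Ext (ModuleCat.of R (R ⧸ B)) M i) = 0 := by
  simp [res]

lemma sub_aux {X X₃ M : ModuleCat.{u} R} {i : ℕ} (a b : X ⟶ X₃) (x : Abelian.Ext X₃ M i)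
    (h1 : (Abelian.Ext.mk₀ a).comp x (zero_add i) = 0)
    (h2 : (Abelian.Ext.mk₀ b).comp x (zero_add i) = 0) :
    (Abelian.Ext.mk₀ (a - b)).comp x (zero_add i) = 0 := by
  rw [sub_eq_add_neg, Abelian.Ext.mk₀_add, Abelian.Ext.mk₀_neg, Abelian.Ext.add_comp,
    Abelian.Ext.neg_comp, h1, h2, neg_zero, add_zero]

lemma nat_aux {S₁ S₂ : ShortComplex (ModuleCat.{u} R)} (h₁ : S₁.ShortExact) (h₂ : S₂.ShortExact)
    (f : S₁ ⟶ S₂) {M : ModuleCat.{u} R} {i : ℕ} (y : Abelian.Ext S₂.X₁ M i)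
    (h : (Abelian.Ext.mk₀ f.τ₁).comp y (zero_add i) = 0) :
    (Abelian.Ext.mk₀ f.τ₃).comp (h₂.extClass.comp y (add_comm 1 i)) (zero_add (i + 1)) = 0 := by
  have := ShortComplex.ShortExact.extClass_naturality h₁ h₂ f
  have e := congrArg (fun q => q.comp y (add_comm 1 i)) this
  rw [Abelian.Ext.comp_assoc (a₂₃ := i) _ _ _ _ (by omega) (by omega),
    Abelian.Ext.comp_assoc (a₂₃ := i + 1) _ _ _ _ (by omega) (by omega)] at e
  refine e.symm.trans ?_
  rw [h, Abelian.Ext.comp_zero]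

lemma mv_exact {A B : Ideal R} {M : ModuleCat.{u} R} {i : ℕ}
    (x : Abelian.Ext (ModuleCat.of R (R ⧸ (A ⊔ B))) M (i + 1))
    (h1 : res le_sup_left x = 0) (h2 : res le_sup_right x = 0) :
    ∃ y : Abelian.Ext (ModuleCat.of R (R ⧸ (A ⊓ B))) M i,
      (mvS_exact A B).extClass.comp y (add_comm 1 i) = x := by
  apply Abelian.Ext.contravariant_sequence_exact₃ (mvS_exact A B) M x _ (add_comm 1 i)
  let p₁ : ModuleCat.of R ((R ⧸ A) × (R ⧸ B)) ⟶ ModuleCat.of R (R ⧸ A) :=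
    ModuleCat.ofHom (LinearMap.fst R _ _)
  let p₂ : ModuleCat.of R ((R ⧸ A) × (R ⧸ B)) ⟶ ModuleCat.of R (R ⧸ B) :=
    ModuleCat.ofHom (LinearMap.snd R _ _)
  have : (mvS A B).g = p₁ ≫ qm le_sup_left - p₂ ≫ qm le_sup_right := by
    ext ⟨x, y⟩
    obtain ⟨x, rfl⟩ := Submodule.Quotient.mk_surjective _ x
    obtain ⟨y, rfl⟩ := Submodule.Quotient.mk_surjective _ y
    change (Submodule.Quotient.mk x : R ⧸ (A ⊔ B)) + - Submodule.Quotient.mk y =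
      Submodule.Quotient.mk x - Submodule.Quotient.mk y
    rw [sub_eq_add_neg]
  have e1 := congrArg (fun q => (Abelian.Ext.mk₀ p₁).comp q (zero_add (i + 1))) h1
  have e2 := congrArg (fun q => (Abelian.Ext.mk₀ p₂).comp q (zero_add (i + 1))) h2
  simp only [res, Abelian.Ext.comp_zero, Abelian.Ext.mk₀_comp_mk₀_assoc] at e1 e2
  rw [this]
  exact sub_aux _ _ _ e1 e2

lemma mv_nat {A B A' B' : Ideal R} (hA : A' ≤ A) (hB : B' ≤ B) {M : ModuleCat.{u} R} {i : ℕ}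
    (y : Abelian.Ext (ModuleCat.of R (R ⧸ (A ⊓ B))) M i) (h : res (inf_le_inf hA hB) y = 0) :
    res (sup_le_sup hA hB) ((mvS_exact A B).extClass.comp y (add_comm 1 i)) = 0 := by
  exact nat_aux (mvS_exact A' B') (mvS_exact A B) (mvMap hA hB) y h

lemma pow_inf_pow [IsNoetherianRing R] (I J : Ideal R) (s : ℕ) :
    ∃ t, s ≤ t ∧ I ^ t ⊓ J ^ t ≤ (I ⊓ J) ^ s := by
  obtain ⟨k, hk⟩ := I.exists_pow_inf_eq_pow_smul (M := R) (J ^ s)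
  refine ⟨s + k, by omega, ?_⟩
  have h := hk (s + k) (by omega)
  have h1 : I ^ (s + k) ⊓ J ^ (s + k) ≤ I ^ (s + k) • ⊤ ⊓ J ^ s := by
    refine inf_le_inf ?_ (Ideal.pow_le_pow_right (by omega))
    simp
  refine h1.trans (h.le.trans ?_)
  rw [Nat.add_sub_cancel]
  refine (Submodule.smul_mono (le_refl (I ^ s)) inf_le_right).trans ?_
  rw [smul_eq_mul, ← mul_pow]
  exact Ideal.pow_right_mono Ideal.mul_le_inf s

lemma sup_pow_le (I J : Ideal R) (t : ℕ) : I ^ t ⊔ J ^ t ≤ (I ⊔ J) ^ t :=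
  sup_le (Ideal.pow_right_mono le_sup_left t) (Ideal.pow_right_mono le_sup_right t)

lemma pow_sup_le (I J : Ideal R) (t : ℕ) : (I ⊔ J) ^ (t + t) ≤ I ^ t ⊔ J ^ t := 
  Ideal.sup_pow_add_le_pow_sup_pow

lemma dies_mv [IsNoetherianRing R] (J₁ J₂ : Ideal R) (i : ℕ) (M : ModuleCat.{u} R)
    (h0 : Dies (J₁ ⊓ J₂) i M) (h1 : Dies J₁ (i + 1) M) (h2 : Dies J₂ (i + 1) M) :
    Dies (J₁ ⊔ J₂) (i + 1) M := by
  intro t x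
  let x₀ := res (sup_pow_le J₁ J₂ t) x
  obtain ⟨s₁, hs₁, e₁⟩ := h1 t (res le_sup_left x₀)
  obtain ⟨s₂, hs₂, e₂⟩ := h2 t (res le_sup_right x₀)
  change res _ _ = 0 at e₁ e₂
  let s := max s₁ s₂
  have k₁ : J₁ ^ s ≤ J₁ ^ s₁ := Ideal.pow_le_pow_right (le_max_left _ _)
  have k₂ : J₂ ^ s ≤ J₂ ^ s₂ := Ideal.pow_le_pow_right (le_max_right _ _)
  have m₁ : J₁ ^ s ≤ J₁ ^ t := Ideal.pow_le_pow_right (hs₁.trans (le_max_left _ _))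
  have m₂ : J₂ ^ s ≤ J₂ ^ t := Ideal.pow_le_pow_right (hs₁.trans (le_max_left _ _))
  let x₁ := res (sup_le_sup m₁ m₂) x₀
  have f₁ : res le_sup_left x₁ = 0 := by
    have := congrArg (res k₁) e₁
    simp only [res_res, res_zero] at this
    simpa only [x₁, res_res] using this
  have f₂ : res le_sup_right x₁ = 0 := by
    have := congrArg (res k₂) e₂
    simp only [res_res, res_zero] at this
    simpa only [x₁, res_res] using this
  obtain ⟨y, hy⟩ := mv_exact x₁ f₁ f₂
  have q : (J₁ ⊓ J₂) ^ s ≤ J₁ ^ s ⊓ J₂ ^ s :=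
    le_inf (Ideal.pow_right_mono inf_le_left s) (Ideal.pow_right_mono inf_le_right s)
  obtain ⟨r, hr, e⟩ := h0 s (res q y)
  change res _ _ = 0 at e
  obtain ⟨w, hw, hw'⟩ := pow_inf_pow J₁ J₂ r
  have n₁ : J₁ ^ w ≤ J₁ ^ s := Ideal.pow_le_pow_right (hr.trans hw)
  have n₂ : J₂ ^ w ≤ J₂ ^ s := Ideal.pow_le_pow_right (hr.trans hw)
  have f : res (inf_le_inf n₁ n₂) y = 0 := by
    have := congrArg (res hw') e
    simpa only [res_res, res_zero] using this
  have g := mv_nat n₁ n₂ y f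
  rw [hy] at g
  have g' := congrArg (res (pow_sup_le J₁ J₂ w)) g
  have htw : t ≤ w := (hs₁.trans (le_max_left _ _)).trans (hr.trans hw)
  refine ⟨w + w, by omega, ?_⟩
  simp only [x₁, x₀, res_res, res_zero] at g'
  exact g'

lemma subsingleton_of_radical [IsNoetherianRing R] {I J : Ideal R} (h : I.radical = J.radical)
    (i : ℕ) (M : ModuleCat.{u} R) (hs : Subsingleton ((localCohomology I i).obj M)) :
    Subsingleton ((localCohomology J i).obj M) :=
  ((localCohomology.isoOfSameRadical h i).app M).toLinearEquiv.symm.toEquiv.subsingleton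

end LCAux

end

open IsLocalRing

/-- Mayer–Vietoris vanishing: if `√(J₁ ∩ J₂) = √I`, `√(J₁ + J₂) = 𝔪`, and
`H^{d-1}_I(R) = H^d_{J₁}(R) = H^d_{J₂}(R) = 0`, then `H^d_𝔪(R) = 0`. -/
theorem lc_top_maximal_vanishing {R : Type u} [CommRing R] [IsNoetherianRing R] [IsLocalRing R]
    (d : ℕ) (hd : ringKrullDim R = d) (I J₁ J₂ : Ideal R)
    (h1 : (J₁ ⊓ J₂).radical = I.radical)
    (h2 : (J₁ + J₂).radical = maximalIdeal R)
    (h3 : Subsingleton ((localCohomology I (d - 1)).obj (ModuleCat.of R R)))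
    (h4 : Subsingleton ((localCohomology J₁ d).obj (ModuleCat.of R R)))
    (h5 : Subsingleton ((localCohomology J₂ d).obj (ModuleCat.of R R))) :
    Subsingleton ((localCohomology (maximalIdeal R) d).obj (ModuleCat.of R R)) := by
  cases d with
  | zero =>
    refine LCAux.subsingleton_of_radical (I := J₁) ?_ _ _ h4
    have hz : Ring.KrullDimLE 0 R := by
      rw [Ring.krullDimLE_iff, hd]
    have hJ : J₁ ≤ maximalIdeal R := by
      rw [← h2]
      exact le_sup_left.trans Ideal.le_radical
    apply le_antisymm (Ideal.radical_mono hJ)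
    rw [Ideal.radical_le_radical_iff]
    rw [Ideal.radical_eq_sInf]
    refine le_sInf ?_
    rintro P ⟨_, hP⟩
    have : P.IsMaximal := hP.isMaximal'
    exact (eq_maximalIdeal this).ge
  | succ n =>
    refine LCAux.subsingleton_of_radical (I := J₁ ⊔ J₂) ?_ _ _ ?_
    · rw [← h2, Ideal.radical_idem]; rfl
    · exact LCAux.of_dies (LCAux.dies_mv J₁ J₂ n _
        (LCAux.dies_of (LCAux.subsingleton_of_radical h1.symm _ _ h3))
        (LCAux.dies_of h4) (LCAux.dies_of h5))
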